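/- Define the total operators D^a f = Σ_{r=1}^m D_r^a f for a ∈ {+, 0, −} and Ω f = D⁰(D⁰ f) + (1/2)·(D⁺(D⁻ f) + D⁻(D⁺ f)). Then for every holomorphic function f on an open set U ⊆ ℂ^m and every x ∈ U: Σ_{r=1}^m z_r·(H_r f)(x) = (1/2)·( (Ω f)(x) − (Σ_{r=1}^m j_r·(j_r+1))·f(x) ). In particular, together with Σ_r H_r = 0, only m−3 of the Hamiltonians H_r are independent modulo the total sl₂ action. -/

import Mathlib

/-- Complex partial derivative `∂f/∂x_r` (this is `D_r⁺ f`). -/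
noncomputable def pd {m : ℕ} (r : Fin m) (f : (Fin m → ℂ) → ℂ) : (Fin m → ℂ) → ℂ :=
  fun x => fderiv ℂ f x (Pi.single r 1)

/-- `D_r⁰ f = x_r ∂f/∂x_r - j_r f`. -/
noncomputable def D0 {m : ℕ} (j : Fin m → ℂ) (r : Fin m) (f : (Fin m → ℂ) → ℂ) :
    (Fin m → ℂ) → ℂ :=
  fun x => x r * pd r f x - j r * f x

/-- `D_r⁻ f = 2 j_r x_r f - x_r² ∂f/∂x_r`. -/
noncomputable def Dm {m : ℕ} (j : Fin m → ℂ) (r : Fin m) (f : (Fin m → ℂ) → ℂ) :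
    (Fin m → ℂ) → ℂ :=
  fun x => 2 * j r * x r * f x - (x r) ^ 2 * pd r f x

/-- The Gaudin Hamiltonian
`H_r f = ∑_{s≠r} (1/(z_r-z_s)) (D_r⁰ D_s⁰ f + ½ D_r⁺ D_s⁻ f + ½ D_r⁻ D_s⁺ f)`. -/
noncomputable def Ham {m : ℕ} (z j : Fin m → ℂ) (r : Fin m) (f : (Fin m → ℂ) → ℂ) :
    (Fin m → ℂ) → ℂ :=
  fun x => ∑ s ∈ Finset.univ.erase r, (1 / (z r - z s)) *
    (D0 j r (D0 j s f) x + (1 / 2) * pd r (Dm j s f) x + (1 / 2) * Dm j r (pd s f) x)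

/-- Total raising operator `D⁺ f = ∑_r D_r⁺ f`. -/
noncomputable def DpT {m : ℕ} (f : (Fin m → ℂ) → ℂ) : (Fin m → ℂ) → ℂ :=
  fun x => ∑ r, pd r f x

/-- Total Cartan operator `D⁰ f = ∑_r D_r⁰ f`. -/
noncomputable def D0T {m : ℕ} (j : Fin m → ℂ) (f : (Fin m → ℂ) → ℂ) : (Fin m → ℂ) → ℂ :=
  fun x => ∑ r, D0 j r f x

/-- Total lowering operator `D⁻ f = ∑_r D_r⁻ f`. -/
noncomputable def DmT {m : ℕ} (j : Fin m → ℂ) (f : (Fin m → ℂ) → ℂ) : (Fin m → ℂ) → ℂ :=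
  fun x => ∑ r, Dm j r f x

/-- Total Casimir `Ω f = D⁰ D⁰ f + ½ (D⁺ D⁻ f + D⁻ D⁺ f)`. -/
noncomputable def Omega {m : ℕ} (j : Fin m → ℂ) (f : (Fin m → ℂ) → ℂ) : (Fin m → ℂ) → ℂ :=
  fun x => D0T j (D0T j f) x + (1 / 2) * (DpT (DmT j f) x + DmT j (DpT f) x)

open Metric Filter Topology MeasureTheory

/-- On a finite-dimensional complex space, the directional derivatives of a holomorphic function
are holomorphic. -/
theorem differentiableOn_fderiv_apply_of_complex {E : Type*} [NormedAddCommGroup E]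
    [NormedSpace ℂ E] [FiniteDimensional ℂ E] {f : E → ℂ} {U : Set E}
    (hf : DifferentiableOn ℂ f U) (hU : IsOpen U) (v : E) :
    DifferentiableOn ℂ (fun x => fderiv ℂ f x v) U := by
  intro x hx
  apply DifferentiableAt.differentiableWithinAt
  have : ProperSpace E := FiniteDimensional.proper ℂ E
  borelize E
  obtain ⟨δ, hδ, hball⟩ : ∃ δ > 0, ball x δ ⊆ {y | y ∈ U ∧ f y ∈ ball (f x) 1} :=
    Metric.mem_nhds_iff.1 <| Filter.inter_mem (hU.mem_nhds hx)
      ((hf.differentiableAt (hU.mem_nhds hx)).continuousAt (ball_mem_nhds _ one_pos))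
  have hd : ∀ y ∈ ball x δ, DifferentiableAt ℂ f y := fun y hy =>
    hf.differentiableAt (hU.mem_nhds (hball hy).1)
  have hbound : ∀ y ∈ ball x (δ / 2), ‖fderiv ℂ f y‖ ≤ 2 / (δ / 2) := by
    intro y hy
    have hsub : ball y (δ / 2) ⊆ ball x δ := by
      apply ball_subset_ball'
      rw [mem_ball] at hy
      linarith
    refine Complex.norm_fderiv_le_div_of_mapsTo_ball
      (fun u hu => (hd u (hsub hu)).differentiableWithinAt) (fun u hu => ?_) (by positivity)
    have h₁ := (hball (hsub hu)).2
    have h₂ := (hball (hsub (mem_ball_self (by positivity)))).2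
    rw [mem_ball] at h₁ h₂
    rw [mem_closedBall]
    linarith [dist_triangle_right (f u) (f y) (f x)]
  set r : ℝ := δ / 4 / (‖v‖ + 1) with hr
  have hr0 : 0 < r := by positivity
  have hmem : ∀ y ∈ ball x (δ / 4), ∀ w ∈ closedBall (0 : ℂ) r, y + w • v ∈ ball x (δ / 2) := by
    intro y hy w hw
    rw [mem_ball_iff_norm] at hy ⊢
    rw [mem_closedBall_zero_iff] at hw
    have h₁ : ‖w • v‖ ≤ δ / 4 := by
      rw [norm_smul]
      calc ‖w‖ * ‖v‖ ≤ r * (‖v‖ + 1) := by gcongr; linarith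
        _ = δ / 4 := by rw [hr]; field_simp
    calc ‖y + w • v - x‖ = ‖(y - x) + w • v‖ := by congr 1; abel
      _ ≤ ‖y - x‖ + ‖w • v‖ := norm_add_le _ _
      _ < δ / 2 := by linarith
  have hhalf : ball x (δ / 2) ⊆ ball x δ := ball_subset_ball (by linarith)
  have hcauchy : ∀ y ∈ ball x (δ / 4),
      fderiv ℂ f y v = Complex.cderiv r (fun w : ℂ => f (y + w • v)) 0 := by
    intro y hy
    have hline : ∀ w : ℂ, HasDerivAt (fun w : ℂ => y + w • v) v w := fun w => by
      simpa using ((hasDerivAt_id w).smul_const v).const_add y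
    rw [Complex.cderiv_eq_deriv (U := (fun w : ℂ => y + w • v) ⁻¹' ball x (δ / 2))
      (isOpen_ball.preimage (by fun_prop)) _ hr0 (hmem y hy)]
    · have hy' : DifferentiableAt ℂ f (y + (0 : ℂ) • v) :=
        hd _ (hhalf (hmem y hy 0 (by simp [hr0.le])))
      have := (hy'.hasFDerivAt.comp_hasDerivAt (0 : ℂ) (hline 0)).deriv
      simpa [Function.comp_def] using this.symm
    · intro w hw
      exact (DifferentiableAt.comp w (hd _ (hhalf hw))
        (hline w).differentiableAt).differentiableWithinAt
  have hx4 : ball x (δ / 4) ∈ 𝓝 x := ball_mem_nhds _ (by positivity)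
  refine DifferentiableAt.congr_of_eventuallyEq ?_ (eventually_of_mem hx4 hcauchy)
  unfold Complex.cderiv circleIntegral
  refine DifferentiableAt.fun_const_smul ?_ _
  have hcm : ∀ θ, circleMap 0 r θ ∈ closedBall (0 : ℂ) r := circleMap_mem_closedBall 0 hr0.le
  have hne : ∀ θ, circleMap 0 r θ - 0 ≠ 0 := fun θ =>
    sub_ne_zero.2 (circleMap_ne_center hr0.ne')
  have hcoef : Continuous fun θ : ℝ => deriv (circleMap 0 r) θ * ((circleMap 0 r θ - 0) ^ 2)⁻¹ := by
    simp only [deriv_circleMap]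
    exact ((continuous_circleMap 0 r).mul continuous_const).mul
      ((((continuous_circleMap 0 r).sub continuous_const).pow 2).inv₀
        fun θ => pow_ne_zero 2 (hne θ))
  have hcont : ∀ y ∈ ball x (δ / 4), Continuous fun θ : ℝ =>
      (deriv (circleMap 0 r) θ * ((circleMap 0 r θ - 0) ^ 2)⁻¹) • f (y + circleMap 0 r θ • v) := by
    intro y hy
    refine hcoef.smul (continuous_iff_continuousAt.2 fun θ => ?_)
    exact ContinuousAt.comp (f := fun θ : ℝ => y + circleMap 0 r θ • v)
      (hd _ (hhalf (hmem y hy _ (hcm θ)))).continuousAt (by fun_prop)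
  simp only [smul_smul]
  refine (intervalIntegral.hasFDerivAt_integral_of_dominated_of_fderiv_le
    (F' := fun y θ => (deriv (circleMap 0 r) θ * ((circleMap 0 r θ - 0) ^ 2)⁻¹) •
      fderiv ℂ f (y + circleMap 0 r θ • v))
    (bound := fun θ => ‖deriv (circleMap 0 r) θ * ((circleMap 0 r θ - 0) ^ 2)⁻¹‖ * (2 / (δ / 2)))
    hx4 (eventually_of_mem hx4 fun y hy => (hcont y hy).aestronglyMeasurable)
    ((hcont x (mem_of_mem_nhds hx4)).intervalIntegrable _ _) ?_ ?_
    ((hcoef.norm.mul continuous_const).intervalIntegrable _ _) ?_).differentiableAt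
  · refine hcoef.aestronglyMeasurable.smul (Measurable.aestronglyMeasurable ?_)
    exact (measurable_fderiv ℂ f).comp (by fun_prop : Continuous _).measurable
  · refine ae_of_all _ fun θ _ y hy => ?_
    rw [norm_smul]
    gcongr
    exact hbound _ (hmem y hy _ (hcm θ))
  · refine ae_of_all _ fun θ _ y hy => ?_
    have h := (hd _ (hhalf (hmem y hy _ (hcm θ)))).hasFDerivAt
    exact ((hasFDerivAt_comp_add_right _).2 h).fun_const_smul
      (deriv (circleMap 0 r) θ * ((circleMap 0 r θ - 0) ^ 2)⁻¹)

/-- A map into the continuous linear maps out of a finite-dimensional space is differentiable if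
all its evaluations are. -/
theorem differentiableOn_clm_of_apply {𝕜 D E F : Type*} [NontriviallyNormedField 𝕜]
    [CompleteSpace 𝕜] [NormedAddCommGroup D] [NormedSpace 𝕜 D] [NormedAddCommGroup E]
    [NormedSpace 𝕜 E] [FiniteDimensional 𝕜 E] [NormedAddCommGroup F] [NormedSpace 𝕜 F]
    {f : D → E →L[𝕜] F} {s : Set D}
    (h : ∀ y, DifferentiableOn 𝕜 (fun x => f x y) s) : DifferentiableOn 𝕜 f s := by
  let d := Module.finrank 𝕜 E
  have hd : d = Module.finrank 𝕜 (Fin d → 𝕜) := (Module.finrank_fin_fun 𝕜).symm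
  let e₁ := ContinuousLinearEquiv.ofFinrankEq hd
  let e₂ := (e₁.arrowCongr (1 : F ≃L[𝕜] F)).trans (ContinuousLinearEquiv.piRing (Fin d))
  rw [← e₂.comp_differentiableOn_iff]
  exact differentiableOn_pi.2 fun i => h _

/-- Second complex derivatives of a holomorphic function on a finite-dimensional space commute. -/
theorem fderiv_fderiv_apply_comm_of_complex {E : Type*} [NormedAddCommGroup E]
    [NormedSpace ℂ E] [FiniteDimensional ℂ E] {f : E → ℂ} {U : Set E}
    (hf : DifferentiableOn ℂ f U) (hU : IsOpen U) {x : E} (hx : x ∈ U) (v w : E) :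
    fderiv ℂ (fun y => fderiv ℂ f y v) x w = fderiv ℂ (fun y => fderiv ℂ f y w) x v := by
  have hd : DifferentiableAt ℂ (fderiv ℂ f) x :=
    (differentiableOn_clm_of_apply
      (differentiableOn_fderiv_apply_of_complex hf hU)).differentiableAt (hU.mem_nhds hx)
  have hsymm := second_derivative_symmetric_of_eventually
    (eventually_of_mem (hU.mem_nhds hx) fun y hy =>
      (hf.differentiableAt (hU.mem_nhds hy)).hasFDerivAt) hd.hasFDerivAt
  simp [fderiv_clm_apply hd (differentiableAt_const _), hsymm v w]

section Gaudin

variable {m : ℕ} {j x : Fin m → ℂ} {f g : (Fin m → ℂ) → ℂ} {U : Set (Fin m → ℂ)}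

theorem differentiableOn_pd (hf : DifferentiableOn ℂ f U) (hU : IsOpen U) (s : Fin m) :
    DifferentiableOn ℂ (pd s f) U :=
  differentiableOn_fderiv_apply_of_complex hf hU _

theorem pd_pd_comm (hf : DifferentiableOn ℂ f U) (hU : IsOpen U) (hx : x ∈ U) (r s : Fin m) :
    pd r (pd s f) x = pd s (pd r f) x :=
  fderiv_fderiv_apply_comm_of_complex hf hU hx _ _

theorem pd_sub (r : Fin m) (hf : DifferentiableAt ℂ f x) (hg : DifferentiableAt ℂ g x) :
    pd r (fun y => f y - g y) x = pd r f x - pd r g x := by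
  simp [pd, fderiv_fun_sub hf hg]

theorem pd_mul (r : Fin m) (hf : DifferentiableAt ℂ f x) (hg : DifferentiableAt ℂ g x) :
    pd r (fun y => f y * g y) x = f x * pd r g x + g x * pd r f x := by
  simp [pd, fderiv_fun_mul hf hg]

theorem pd_const (r : Fin m) (c : ℂ) : pd r (fun _ => c) x = 0 := by
  simp [pd]

theorem pd_coord (r s : Fin m) : pd r (fun y => y s) x = if s = r then 1 else 0 := by
  simp [pd, fderiv_apply, Pi.single_apply]

theorem pd_sum {F : Fin m → (Fin m → ℂ) → ℂ} (r : Fin m)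
    (hF : ∀ s, DifferentiableAt ℂ (F s) x) :
    pd r (fun y => ∑ s, F s y) x = ∑ s, pd r (F s) x := by
  simp [pd, fderiv_fun_sum fun s _ => hF s]

theorem differentiableAt_D0 (hf : DifferentiableOn ℂ f U) (hU : IsOpen U) (hx : x ∈ U)
    (s : Fin m) : DifferentiableAt ℂ (D0 j s f) x := by
  have h₀ := hf.differentiableAt (hU.mem_nhds hx)
  have h₁ := (differentiableOn_pd hf hU s).differentiableAt (hU.mem_nhds hx)
  unfold D0
  fun_prop

theorem differentiableAt_Dm (hf : DifferentiableOn ℂ f U) (hU : IsOpen U) (hx : x ∈ U)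
    (s : Fin m) : DifferentiableAt ℂ (Dm j s f) x := by
  have h₀ := hf.differentiableAt (hU.mem_nhds hx)
  have h₁ := (differentiableOn_pd hf hU s).differentiableAt (hU.mem_nhds hx)
  unfold Dm
  fun_prop

theorem pd_D0 (hf : DifferentiableOn ℂ f U) (hU : IsOpen U) (hx : x ∈ U) (r s : Fin m) :
    pd r (D0 j s f) x =
      x s * pd r (pd s f) x + pd s f x * (if s = r then 1 else 0) - j s * pd r f x := by
  have h₀ := hf.differentiableAt (hU.mem_nhds hx)
  have h₁ := (differentiableOn_pd hf hU s).differentiableAt (hU.mem_nhds hx)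
  unfold D0
  rw [pd_sub r (by fun_prop) (by fun_prop), pd_mul r (by fun_prop) h₁,
    pd_mul r (by fun_prop) h₀, pd_const, pd_coord]
  ring

theorem pd_Dm (hf : DifferentiableOn ℂ f U) (hU : IsOpen U) (hx : x ∈ U) (r s : Fin m) :
    pd r (Dm j s f) x =
      2 * j s * (x s * pd r f x + f x * (if s = r then 1 else 0))
        - (x s ^ 2 * pd r (pd s f) x + 2 * x s * pd s f x * (if s = r then 1 else 0)) := by
  have h₀ := hf.differentiableAt (hU.mem_nhds hx)
  have h₁ := (differentiableOn_pd hf hU s).differentiableAt (hU.mem_nhds hx)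
  have hsq : pd r (fun y => y s ^ 2) x = 2 * x s * (if s = r then 1 else 0) := by
    simp only [pow_two]
    rw [pd_mul r (by fun_prop) (by fun_prop), pd_coord]
    ring
  unfold Dm
  rw [pd_sub r (by fun_prop) (by fun_prop), pd_mul r (by fun_prop) h₀,
    pd_mul r (by fun_prop) (by fun_prop), pd_mul r (by fun_prop) h₁, pd_const, pd_coord, hsq]
  ring

/-- The two-site term `D_r⁰ D_s⁰ f + ½ D_r⁺ D_s⁻ f + ½ D_r⁻ D_s⁺ f` of the Gaudin Hamiltonian. -/
noncomputable def siteCasimir (j : Fin m → ℂ) (r s : Fin m) (f : (Fin m → ℂ) → ℂ)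
    (x : Fin m → ℂ) : ℂ :=
  D0 j r (D0 j s f) x + (1 / 2) * pd r (Dm j s f) x + (1 / 2) * Dm j r (pd s f) x

theorem siteCasimir_comm (hf : DifferentiableOn ℂ f U) (hU : IsOpen U) (hx : x ∈ U)
    {r s : Fin m} (hrs : r ≠ s) : siteCasimir j r s f x = siteCasimir j s r f x := by
  unfold siteCasimir
  simp only [D0.eq_1 j r (D0 j s f), D0.eq_1 j s (D0 j r f), pd_D0 hf hU hx, pd_Dm hf hU hx]
  simp only [Dm, D0, pd_pd_comm hf hU hx r s, if_neg hrs, if_neg hrs.symm]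
  ring

theorem siteCasimir_self (hf : DifferentiableOn ℂ f U) (hU : IsOpen U) (hx : x ∈ U)
    (r : Fin m) : siteCasimir j r r f x = j r * (j r + 1) * f x := by
  unfold siteCasimir
  rw [pd_Dm hf hU hx, D0, pd_D0 hf hU hx, Dm, D0, if_pos rfl]
  ring

theorem Omega_eq_sum_siteCasimir (hf : DifferentiableOn ℂ f U) (hU : IsOpen U) (hx : x ∈ U) :
    Omega j f x = ∑ r, ∑ s, siteCasimir j r s f x := by
  have h₀ : ∀ r, D0 j r (D0T j f) x = ∑ s, D0 j r (D0 j s f) x := fun r => by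
    unfold D0T
    rw [D0, pd_sum r fun s => differentiableAt_D0 hf hU hx s, Finset.mul_sum, Finset.mul_sum,
      ← Finset.sum_sub_distrib]
    rfl
  have h₁ : ∀ r, pd r (DmT j f) x = ∑ s, pd r (Dm j s f) x := fun r =>
    pd_sum r fun s => differentiableAt_Dm hf hU hx s
  have h₂ : ∀ r, Dm j r (DpT f) x = ∑ s, Dm j r (pd s f) x := fun r => by
    unfold DpT
    rw [Dm, pd_sum r fun s => (differentiableOn_pd hf hU s).differentiableAt (hU.mem_nhds hx),
      Finset.mul_sum, Finset.mul_sum, ← Finset.sum_sub_distrib]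
    rfl
  rw [Omega, D0T, DpT, DmT]
  simp only [h₀, h₁, h₂, siteCasimir, Finset.sum_add_distrib, ← Finset.mul_sum]
  ring

end Gaudin

/-- For a symmetric kernel `T`, the weights `z_r / (z_r - z_s)` and `z_s / (z_s - z_r)` add up
to one. -/
theorem sum_mul_sum_erase_div_sub {ι K : Type*} [Fintype ι] [DecidableEq ι] [Field K] [CharZero K]
    {z : ι → K} (hz : Function.Injective z) {T : ι → ι → K} (hT : ∀ r s, r ≠ s → T r s = T s r) :
    ∑ r, z r * ∑ s ∈ Finset.univ.erase r, (1 / (z r - z s)) * T r s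
      = (1 / 2) * (∑ r, ∑ s, T r s - ∑ r, T r r) := by
  have hoff : ∀ A : ι → ι → K, ∑ r, ∑ s ∈ Finset.univ.erase r, A r s
      = ∑ r, ∑ s, if r = s then 0 else A r s := fun A => by
    refine Finset.sum_congr rfl fun r _ => ?_
    rw [← Finset.sum_erase (a := r) Finset.univ (by simp)]
    exact Finset.sum_congr rfl fun s hs => by simp [(Finset.ne_of_mem_erase hs).symm]
  have hdiag : ∑ r, ∑ s, T r s - ∑ r, T r r = ∑ r, ∑ s, if r = s then 0 else T r s := by
    rw [← hoff, ← Finset.sum_sub_distrib]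
    exact Finset.sum_congr rfl fun r _ => by rw [Finset.sum_erase_eq_sub (Finset.mem_univ r)]
  simp only [Finset.mul_sum]
  rw [hdiag, hoff, eq_comm, one_div, inv_mul_eq_iff_eq_mul₀ two_ne_zero, two_mul]
  conv_rhs => rw [← Finset.sum_comm]
  conv_rhs => enter [2]; rw [Finset.sum_comm]
  simp only [← Finset.sum_add_distrib]
  refine Finset.sum_congr rfl fun r _ => Finset.sum_congr rfl fun s _ => ?_
  by_cases h : r = s
  · simp [h]
  · have h₁ : z r - z s ≠ 0 := sub_ne_zero.2 (hz.ne h)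
    have h₂ : z s - z r ≠ 0 := sub_ne_zero.2 (hz.ne (Ne.symm h))
    rw [if_neg h, if_neg h, if_neg (Ne.symm h), hT s r (Ne.symm h)]
    rw [← neg_sub (z r) (z s)] at h₂ ⊢
    field_simp
    ring

/-- `∑_r z_r H_r f = ½ (Ω f - (∑_r j_r(j_r+1)) f)` on holomorphic
functions; together with `∑_r H_r = 0` this reflects that only `m-3` of the `H_r` are
independent modulo the total `sl₂` action. -/
theorem statement18 (m : ℕ) (hm : 2 ≤ m) (z : Fin m → ℂ) (hz : Function.Injective z)
    (j : Fin m → ℂ) (U : Set (Fin m → ℂ)) (hU : IsOpen U)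
    (f : (Fin m → ℂ) → ℂ) (hf : DifferentiableOn ℂ f U) (x : Fin m → ℂ) (hx : x ∈ U) :
    ∑ r, z r * Ham z j r f x
      = (1 / 2) * (Omega j f x - (∑ r, j r * (j r + 1)) * f x) := by
  rw [Omega_eq_sum_siteCasimir hf hU hx, Finset.sum_mul]
  simp only [← siteCasimir_self hf hU hx]
  exact sum_mul_sum_erase_div_sub hz fun r s hrs => siteCasimir_comm hf hU hx hrs
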